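/- Let n ≥ 1 and let P_n = ⟨a_0, …, a_k⟩ be the n-th P-sequence. Then the sign of ∑_{i=1}^k a_i i^n equals (-1)^n; in particular this sum is nonzero. -/

import Mathlib

/-- One step of the recursive construction of P-sequences. -/
def Pnext (a : List ℤ) : List ℤ :=
  if a.getLast! = -a.head! then a ++ a.reverse
  else a.dropLast ++ [0] ++ (a.dropLast.reverse.map (fun x => -x))

/-- `Pseq (n-1)` is the `n`-th P-sequence `P_n` (so `Pseq 0 = P_1 = ⟨1,-1⟩`). -/
def Pseq : ℕ → List ℤ
  | 0 => [1, -1]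
  | n + 1 => Pnext (Pseq n)

open Polynomial in
/-- For `f` of degree at most `n + 1`, the difference `f (X + m) - f` has degree at most `n`. -/
theorem natDegree_taylor_sub_le (m : ℤ) (n : ℕ) (f : ℤ[X]) (hf : f.natDegree ≤ n + 1) :
    (taylor m f - f).natDegree ≤ n := by
  rw [natDegree_le_iff_coeff_eq_zero]
  intro N hN
  have hdeg : (hasseDeriv N f).natDegree < 1 := by
    have := natDegree_hasseDeriv_le f N
    omega
  rw [coeff_sub, taylor_coeff, eval_eq_sum_range' hdeg]
  simp [hasseDeriv_coeff]

open Polynomial in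
/-- The coefficient of degree `n` of `f (X + m) - f`, for `f` of degree at most `n + 1`. -/
theorem coeff_taylor_sub (m : ℤ) (n : ℕ) (f : ℤ[X]) (hf : f.natDegree ≤ n + 1) :
    (taylor m f - f).coeff n = (n + 1) * m * f.coeff (n + 1) := by
  have hdeg : (hasseDeriv n f).natDegree < 2 := by
    have := natDegree_hasseDeriv_le f n
    omega
  rw [coeff_sub, taylor_coeff, eval_eq_sum_range' hdeg]
  simp [hasseDeriv_coeff, Finset.sum_range_succ, add_comm 1 n]
  ring

/-- The weighted sum `∑ i, a_i f(i)` of the values of `f` with weights the entries of a list. -/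
def weightedSum : List ℤ → (ℤ → ℤ) → ℤ
  | [], _ => 0
  | x :: l, f => x * f 0 + weightedSum l (fun t => f (t + 1))

theorem weightedSum_append (a b : List ℤ) (f : ℤ → ℤ) :
    weightedSum (a ++ b) f = weightedSum a f + weightedSum b (fun t => f (t + a.length)) := by
  induction a generalizing f with
  | nil => simp [weightedSum]
  | cons x l ih =>
    simp only [List.cons_append, weightedSum, ih, List.length_cons, Nat.cast_add, Nat.cast_one,
      add_assoc]

theorem weightedSum_map_neg (a : List ℤ) (f : ℤ → ℤ) :
    weightedSum (a.map (fun x => -x)) f = -weightedSum a f := by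
  induction a generalizing f with
  | nil => simp [weightedSum]
  | cons x l ih =>
    simp only [List.map_cons, weightedSum, ih]
    ring

theorem weightedSum_sub (a : List ℤ) (f g : ℤ → ℤ) :
    weightedSum a (fun t => f t - g t) = weightedSum a f - weightedSum a g := by
  induction a generalizing f g with
  | nil => simp [weightedSum]
  | cons x l ih =>
    simp only [weightedSum, ih]
    ring

theorem weightedSum_eq_sum_range (a : List ℤ) (f : ℤ → ℤ) :
    weightedSum a f = ∑ i ∈ Finset.range a.length, a.getD i 0 * f i := by
  induction a generalizing f with
  | nil => simp [weightedSum]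
  | cons x l ih =>
    simp [weightedSum, ih, Finset.sum_range_succ', add_comm]

/-- Lists with leading entry `1` and length at least two that are palindromic or
antipalindromic. -/
def IsSignedPalindrome (a : List ℤ) : Prop :=
  (∃ y t, a = 1 :: y :: t) ∧ (a.reverse = a.map (fun x => -x) ∨ a.reverse = a)

/-- One step of the construction preserves signed palindromes, and corresponds to multiplying
the generating polynomial by `1 - X ^ m` for some `m > 0`. -/
theorem IsSignedPalindrome.next {a : List ℤ} (ha : IsSignedPalindrome a) :
    IsSignedPalindrome (Pnext a) ∧ ∃ m : ℕ, 0 < m ∧ ∀ f : ℤ → ℤ,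
      weightedSum (Pnext a) f =
        weightedSum a f - weightedSum a (fun t => f (t + m)) := by
  obtain ⟨⟨y, t, rfl⟩, h | h⟩ := ha
  · have hlast : (1 :: y :: t).getLast! = -(1 :: y :: t : List ℤ).head! := by
      have := congrArg List.head? h
      rw [List.head?_reverse] at this
      rw [List.getLast!_eq_getLast?_getD, this]
      simp
    rw [Pnext, if_pos hlast]
    refine ⟨⟨⟨y, t ++ (1 :: y :: t).reverse, by simp⟩, Or.inr (by simp)⟩,
      (1 :: y :: t).length, by simp, fun f => ?_⟩
    rw [weightedSum_append, h, weightedSum_map_neg, sub_eq_add_neg]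
  · have hlast : (1 :: y :: t).getLast! ≠ -(1 :: y :: t : List ℤ).head! := by
      have := congrArg List.head? h
      rw [List.head?_reverse] at this
      rw [List.getLast!_eq_getLast?_getD, this]
      simp
    rw [Pnext, if_neg hlast]
    obtain ⟨b, hb⟩ : ∃ b, (1 :: y :: t).dropLast = b := ⟨_, rfl⟩
    have hab : (1 :: y :: t : List ℤ) = b ++ [1] := by
      rw [List.reverse_cons] at h
      rw [← h, ← hb, ← h]
      simp
    have hb' : b = 1 :: (y :: t).dropLast := by rw [← hb]; rfl
    have hrev : (1 :: y :: t : List ℤ) = 1 :: b.reverse := by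
      rw [← h, hab]; simp
    rw [hb]
    refine ⟨⟨?_, Or.inl (by simp)⟩, b.length, by simp [hb'], fun f => ?_⟩
    · rw [hb']
      cases (y :: t).dropLast with
      | nil => exact ⟨_, _, rfl⟩
      | cons z s => exact ⟨_, _, rfl⟩
    · have h1 : weightedSum (1 :: y :: t) f = weightedSum b f + f b.length := by
        rw [hab, weightedSum_append]; simp [weightedSum]
      rw [h1, hrev, weightedSum_append, weightedSum_append, weightedSum_map_neg]
      simp only [weightedSum, List.length_append, List.length_singleton]
      push_cast
      have h2 : (fun s : ℤ => f (s + (b.length + 1))) = fun s : ℤ => f (s + 1 + b.length) := by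
        funext s; congr 1; ring
      rw [h2]
      simp
      ring

theorem isSignedPalindrome_Pseq (n : ℕ) : IsSignedPalindrome (Pseq n) := by
  induction n with
  | zero => exact ⟨⟨-1, [], rfl⟩, Or.inl (by simp [Pseq])⟩
  | succ n ih => exact ih.next.1

open Polynomial in
/-- The weighted sum over `Pseq n` extracts, up to the sign `(-1) ^ (n + 1)` and a positive factor,
the coefficient of degree `n + 1` of polynomials of degree at most `n + 1`. -/
theorem exists_weightedSum_Pseq_eq (n : ℕ) :
    ∃ c : ℤ, 0 < c ∧ ∀ f : ℤ[X], f.natDegree ≤ n + 1 →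
      weightedSum (Pseq n) (fun t => f.eval t) = (-1) ^ (n + 1) * c * f.coeff (n + 1) := by
  induction n with
  | zero =>
    refine ⟨1, one_pos, fun f hf => ?_⟩
    have hdeg : f.natDegree < 2 := by omega
    simp [Pseq, weightedSum, eval_eq_sum_range' hdeg, Finset.sum_range_succ]
  | succ n ih =>
    obtain ⟨c, hc, hcf⟩ := ih
    obtain ⟨m, hm, hmf⟩ := (isSignedPalindrome_Pseq n).next.2
    refine ⟨c * ((n + 1 + 1) * m), by positivity, fun f hf => ?_⟩
    have key := hcf _ (natDegree_taylor_sub_le m (n + 1) f hf)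
    rw [coeff_taylor_sub m (n + 1) f hf] at key
    simp only [eval_sub, taylor_eval, weightedSum_sub] at key
    rw [Pseq, hmf, ← neg_sub, key]
    push_cast
    ring

/-- for `n ≥ 1` and `P_n = ⟨a_0,…,a_k⟩`, the sign of
`∑_{i=1}^k a_i i^n` is `(-1)^n`; in particular this sum is nonzero. -/
theorem Pseq_power_sum_sign (n : ℕ) (hn : 1 ≤ n) :
    (∑ i ∈ Finset.Icc 1 ((Pseq (n - 1)).length - 1),
        (Pseq (n - 1)).getD i 0 * (i : ℤ) ^ n).sign = (-1) ^ n ∧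
    ∑ i ∈ Finset.Icc 1 ((Pseq (n - 1)).length - 1),
        (Pseq (n - 1)).getD i 0 * (i : ℤ) ^ n ≠ 0 := by
  obtain ⟨n, rfl⟩ : ∃ k, n = k + 1 := ⟨n - 1, by omega⟩
  rw [Nat.add_sub_cancel]
  obtain ⟨c, hc, hcf⟩ := exists_weightedSum_Pseq_eq n
  have hsum : ∑ i ∈ Finset.Icc 1 ((Pseq n).length - 1),
      (Pseq n).getD i 0 * (i : ℤ) ^ (n + 1) = (-1) ^ (n + 1) * c := by
    have key := hcf (Polynomial.X ^ (n + 1)) (by simp)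
    rw [weightedSum_eq_sum_range] at key
    simp only [Polynomial.eval_pow, Polynomial.eval_X, Polynomial.coeff_X_pow, if_true,
      mul_one] at key
    rw [← key]
    refine Finset.sum_subset (fun i hi => ?_) (fun i hi hi' => ?_)
    · simp only [Finset.mem_Icc, Finset.mem_range] at hi ⊢
      omega
    · simp only [Finset.mem_Icc, Finset.mem_range] at hi hi'
      obtain rfl : i = 0 := by omega
      simp
  rw [hsum]
  refine ⟨?_, mul_ne_zero (pow_ne_zero _ (by norm_num)) hc.ne'⟩
  rw [Int.sign_mul, Int.sign_eq_one_of_pos hc, mul_one]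
  rcases neg_one_pow_eq_or ℤ (n + 1) with h | h <;> rw [h] <;> rfl
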